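/- arXiv:1703.06123 — 2 statements merged into one kernel-verified Lean document; each statement's English description precedes it below -/
import Mathlib

section
/- For all integers n, m, k, l, h with m ≥ 1, n ≥ m + 2, k ≥ 0, l ≥ 0, h ≥ 1, l ≤ k + 1, and 3·l ≤ 2·k + h, one has (n − 1)·k − n·l + (n − m − 1)·h + m ≥ 1. -/
/-- In the hairy graph complex `HGC_{m,n}`, a connected hairy graph with `k` internal
edges, `l` internal vertices and `h` hairs has homological degree
`(n-1)·k - n·l + (n-m-1)·h + m`.  Under the defining constraints (at least one hair,
internal vertices at least trivalent, nonnegative loop order), this degree is `≥ 1`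
whenever `m ≥ 1` and `n - m ≥ 2`. -/
theorem hairy_graph_degree_ge_one
    (n m k l h : ℤ) (hm : 1 ≤ m) (hn : m + 2 ≤ n) (hk : 0 ≤ k) (hl : 0 ≤ l)
    (hh : 1 ≤ h) (hloop : l ≤ k + 1) (htriv : 3 * l ≤ 2 * k + h) :
    1 ≤ (n - 1) * k - n * l + (n - m - 1) * h + m := by
  have hg : 0 ≤ (n - 3) * (k - l + 1) := mul_nonneg (by lia) (by lia)
  have hd : 0 ≤ (n - m - 2) * (h - 1) := mul_nonneg (by lia) (by lia)
  linarith
end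

section
/- Fix an integer r ≥ 2 and work over ℚ. Let 𝔭(r) denote the Drinfeld–Kohno Lie algebra: the quotient of the free Lie algebra over ℚ on generators t_{ij} = t_{ji}, indexed by the unordered pairs 1 ≤ i < j ≤ r, by the Lie ideal generated by the infinitesimal braid relations [t_{ij}, t_{kl}] for all pairwise distinct indices i, j, k, l, and [t_{ij}, t_{ik} + t_{jk}] for all pairwise distinct indices i, j, k. Then: (a) there is a (unique) Lie algebra homomorphism s₁ : 𝔭(r) → 𝔭(r−1) determined by s₁(t_{1j}) = 0 for 2 ≤ j ≤ r and s₁(t_{ij}) = t_{(i−1)(j−1)} for 2 ≤ i < j ≤ r; and (b) the Lie algebra homomorphism φ from the free Lie algebra over ℚ on r − 1 generators x₂, …, x_r to 𝔭(r) determined by φ(x_j) = t_{1j} is injective and its image equals the kernel of s₁; in other words, ker(s₁) is a free Lie algebra on the generators t_{12}, …, t_{1r}. -/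
noncomputable section

/-- Generators of the Drinfeld–Kohno Lie algebra: ordered pairs `(i, j)` with `i ≠ j`
(the symmetry relation `t i j = t j i` is imposed in the ideal of relations below,
so that this presents the algebra on generators `t_{ij}`, `i < j`, with
`t_{ji} := t_{ij}`). -/
abbrev DKGen (r : ℕ) : Type := {p : Fin r × Fin r // p.1 ≠ p.2}

/-- The free Lie algebra over `ℚ` on the generators `t i j`, `i ≠ j`. -/
abbrev DKFree (r : ℕ) : Type := FreeLieAlgebra ℚ (DKGen r)

/-- The generator `t i j` in the free Lie algebra. -/
def tFree {r : ℕ} (i j : Fin r) (h : i ≠ j) : DKFree r :=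
  FreeLieAlgebra.of ℚ ⟨(i, j), h⟩

/-- The infinitesimal braid (Drinfeld–Kohno) relations `[t i j, t a b]` for pairwise
distinct `i, j, a, b` and `[t i j, t i a + t j a]` for pairwise distinct `i, j, a`,
together with the symmetry relations `t i j = t j i`. -/
def DKRelations (r : ℕ) : Set (DKFree r) :=
  {x | ∃ (i j : Fin r) (h : i ≠ j), x = tFree i j h - tFree j i h.symm} ∪
    {x | ∃ (i j a b : Fin r) (hij : i ≠ j) (hab : a ≠ b),
      i ≠ a ∧ i ≠ b ∧ j ≠ a ∧ j ≠ b ∧ x = ⁅tFree i j hij, tFree a b hab⁆} ∪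
    {x | ∃ (i j a : Fin r) (hij : i ≠ j) (hia : i ≠ a) (hja : j ≠ a),
      x = ⁅tFree i j hij, tFree i a hia + tFree j a hja⁆}

/-- The Lie ideal generated by the Drinfeld–Kohno relations. -/
def DKIdeal (r : ℕ) : LieIdeal ℚ (DKFree r) :=
  LieSubmodule.lieSpan ℚ (DKFree r) (DKRelations r)

/-- The Drinfeld–Kohno Lie algebra `𝔭(r)`. -/
abbrev DK (r : ℕ) : Type := DKFree r ⧸ DKIdeal r

/-- The class of the generator `t i j` in `𝔭(r)`. -/
def tDK {r : ℕ} (i j : Fin r) (h : i ≠ j) : DK r :=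
  LieSubmodule.Quotient.mk (N := DKIdeal r) (tFree i j h)

/-- The Lie algebra morphism from the free Lie algebra over `ℚ` on `r` generators
(indexed by `Fin r`, corresponding to `x_2, …, x_{r+1}` in one-based notation) to
`𝔭(r+1)`, determined by sending the `j`-th generator to `t 0 (j+1)` (that is, in
one-based notation, `x_j ↦ t_{1j}`). -/
def DKphi (r : ℕ) : FreeLieAlgebra ℚ (Fin r) →ₗ⁅ℚ⁆ DK (r + 1) :=
  FreeLieAlgebra.lift ℚ fun j : Fin r =>
    tDK (0 : Fin (r + 1)) j.succ (Ne.symm (Fin.succ_ne_zero j))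

namespace FreeLieAlgebra

variable {R : Type*} [CommRing R] {X : Type*}

/-- A Lie subalgebra of a free Lie algebra that contains the generators is everything. -/
theorem lieSubalgebra_eq_top_of_forall_of_mem (S : LieSubalgebra R (FreeLieAlgebra R X))
    (h : ∀ x, of R x ∈ S) : S = ⊤ := by
  have key : S.incl.comp (lift R fun x => (⟨of R x, h x⟩ : S)) = LieHom.id := by
    ext x
    simp
  refine eq_top_iff.mpr fun a _ => ?_
  have ha := LieHom.congr_fun key a
  simp only [LieHom.comp_apply, LieHom.id_apply] at ha
  rw [← ha]
  exact Subtype.prop _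

section Derivation

variable {M : Type*} [AddCommGroup M] [Module R M] [LieRingModule (FreeLieAlgebra R X) M]
  [LieModule R (FreeLieAlgebra R X) M]

/-- The splitting of the trivial extension of a free Lie algebra by a module `M`
that is given by `f : X → M` on generators. -/
def derivationAux (f : X → M) : FreeLieAlgebra R X →ₗ⁅R⁆
    LieAlgebra.ofTwoCocycle (0 : LieModule.Cohomology.twoCocycle R (FreeLieAlgebra R X) M) :=
  lift R fun x => LieAlgebra.ofProd 0 (of R x, f x)

theorem derivationAux_fst (f : X → M) (a : FreeLieAlgebra R X) :
    ((LieAlgebra.ofProd 0).symm (derivationAux f a)).1 = a := by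
  let p : LieAlgebra.ofTwoCocycle
      (0 : LieModule.Cohomology.twoCocycle R (FreeLieAlgebra R X) M) →ₗ⁅R⁆ FreeLieAlgebra R X :=
    { toFun := fun y => ((LieAlgebra.ofProd 0).symm y).1
      map_add' := fun _ _ => rfl
      map_smul' := fun _ _ => rfl
      map_lie' := rfl }
  have key : p.comp (derivationAux f) = LieHom.id := by
    ext x
    simp only [LieHom.comp_apply, derivationAux, lift_of_apply, LieHom.id_apply]
    rfl
  exact LieHom.congr_fun key a

/-- The derivation of a free Lie algebra with prescribed values on the generators. -/
def derivation (f : X → M) : LieDerivation R (FreeLieAlgebra R X) M where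
  toFun a := ((LieAlgebra.ofProd 0).symm (derivationAux f a)).2
  map_add' a b := by simp
  map_smul' t a := by simp
  leibniz' a b := by
    change ((LieAlgebra.ofProd 0).symm (derivationAux f ⁅a, b⁆)).2 =
      ⁅a, ((LieAlgebra.ofProd 0).symm (derivationAux f b)).2⁆ -
        ⁅b, ((LieAlgebra.ofProd 0).symm (derivationAux f a)).2⁆
    rw [LieHom.map_lie, LieAlgebra.bracket_ofTwoCocycle]
    simp [derivationAux_fst]

@[simp]
theorem derivation_of (f : X → M) (x : X) : derivation f (of R x) = f x := by
  change ((LieAlgebra.ofProd 0).symm (derivationAux f (of R x))).2 = f x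
  simp [derivationAux]

theorem derivation_ext {D₁ D₂ : LieDerivation R (FreeLieAlgebra R X) M}
    (h : ∀ x, D₁ (of R x) = D₂ (of R x)) : D₁ = D₂ := by
  refine LieDerivation.ext_of_lieSpan_eq_top (Set.range (of R))
    (lieSubalgebra_eq_top_of_forall_of_mem _ fun x =>
      LieSubalgebra.subset_lieSpan (Set.mem_range_self x)) ?_
  rintro _ ⟨x, rfl⟩
  exact h x

end Derivation

end FreeLieAlgebra

theorem lie_lie_eq_lie_lie_add {L : Type*} [LieRing L] (x y z : L) :
    ⁅⁅x, y⁆, z⁆ = ⁅⁅x, z⁆, y⁆ + ⁅x, ⁅y, z⁆⁆ := by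
  rw [lie_lie x z y, ← lie_skew z y, lie_neg, ← lie_skew z ⁅x, y⁆]
  abel

section DrinfeldKohno

variable {r : ℕ} {L : Type*} [LieRing L]

/-- A family of elements of a Lie algebra that satisfies the Drinfeld–Kohno relations. -/
structure IsDKFamily (t : Fin r → Fin r → L) : Prop where
  symm : ∀ i j, i ≠ j → t i j = t j i
  lie_eq_zero : ∀ i j a b, i ≠ j → a ≠ b → i ≠ a → i ≠ b → j ≠ a → j ≠ b → ⁅t i j, t a b⁆ = 0
  lie_add_eq_zero : ∀ i j a, i ≠ j → i ≠ a → j ≠ a → ⁅t i j, t i a + t j a⁆ = 0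

theorem IsDKFamily.comp_succ {t : Fin (r + 1) → Fin (r + 1) → L} (ht : IsDKFamily t) :
    IsDKFamily fun i j : Fin r => t i.succ j.succ where
  symm i j h := ht.symm _ _ (by simpa using h)
  lie_eq_zero i j a b hij hab h₁ h₂ h₃ h₄ := by
    apply ht.lie_eq_zero <;> simpa
  lie_add_eq_zero i j a hij hia hja := by
    apply ht.lie_add_eq_zero <;> simpa

variable [LieAlgebra ℚ L]

/-- The morphism from the free Lie algebra on the Drinfeld–Kohno generators to `L`
given by a family of elements. -/
def dkFreeLift (t : Fin r → Fin r → L) : DKFree r →ₗ⁅ℚ⁆ L :=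
  FreeLieAlgebra.lift ℚ fun p : DKGen r => t p.1.1 p.1.2

@[simp]
theorem dkFreeLift_tFree (t : Fin r → Fin r → L) (i j : Fin r) (h : i ≠ j) :
    dkFreeLift t (tFree i j h) = t i j := by
  simp [dkFreeLift, tFree]

theorem IsDKFamily.dkIdeal_le_ker {t : Fin r → Fin r → L} (ht : IsDKFamily t) :
    DKIdeal r ≤ (dkFreeLift t).ker := by
  refine LieSubmodule.lieSpan_le.mpr ?_
  rintro x ((⟨i, j, h, rfl⟩ | ⟨i, j, a, b, hij, hab, h₁, h₂, h₃, h₄, rfl⟩) |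
    ⟨i, j, a, hij, hia, hja, rfl⟩) <;>
  simp only [SetLike.mem_coe, LieHom.mem_ker, LieHom.map_lie, map_add, map_sub, dkFreeLift_tFree]
  · rw [ht.symm i j h, sub_self]
  · exact ht.lie_eq_zero i j a b hij hab h₁ h₂ h₃ h₄
  · exact ht.lie_add_eq_zero i j a hij hia hja

/-- The universal property of the Drinfeld–Kohno Lie algebra. -/
def IsDKFamily.lift {t : Fin r → Fin r → L} (ht : IsDKFamily t) : DK r →ₗ⁅ℚ⁆ L where
  __ := Submodule.liftQ (DKIdeal r).toSubmodule (dkFreeLift t : DKFree r →ₗ[ℚ] L)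
    fun _ hx => LieHom.mem_ker.mp (ht.dkIdeal_le_ker hx)
  map_lie' := by
    rintro ⟨x⟩ ⟨y⟩
    exact LieHom.map_lie (dkFreeLift t) x y

@[simp]
theorem IsDKFamily.lift_tDK {t : Fin r → Fin r → L} (ht : IsDKFamily t) (i j : Fin r)
    (h : i ≠ j) : ht.lift (tDK i j h) = t i j :=
  dkFreeLift_tFree t i j h

/-- The quotient map onto the Drinfeld–Kohno Lie algebra, as a morphism of Lie algebras. -/
def dkMk (r : ℕ) : DKFree r →ₗ⁅ℚ⁆ DK r where
  __ := (DKIdeal r).toSubmodule.mkQ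
  map_lie' := rfl

theorem dkMk_surjective (r : ℕ) : Function.Surjective (dkMk r) :=
  (DKIdeal r).toSubmodule.mkQ_surjective

theorem dkMk_tFree (i j : Fin r) (h : i ≠ j) : dkMk r (tFree i j h) = tDK i j h := rfl

theorem dkMk_eq_zero_of_mem_relations {x : DKFree r} (hx : x ∈ DKRelations r) : dkMk r x = 0 :=
  (Submodule.Quotient.mk_eq_zero _).mpr (LieSubmodule.subset_lieSpan hx)

theorem tDK_symm (i j : Fin r) (h : i ≠ j) : tDK i j h = tDK j i h.symm := by
  have := dkMk_eq_zero_of_mem_relations (Or.inl (Or.inl ⟨i, j, h, rfl⟩))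
  rwa [map_sub, sub_eq_zero] at this

theorem tDK_lie_eq_zero (i j a b : Fin r) (hij : i ≠ j) (hab : a ≠ b) (h₁ : i ≠ a) (h₂ : i ≠ b)
    (h₃ : j ≠ a) (h₄ : j ≠ b) : ⁅tDK i j hij, tDK a b hab⁆ = 0 :=
  dkMk_eq_zero_of_mem_relations (Or.inl (Or.inr ⟨i, j, a, b, hij, hab, h₁, h₂, h₃, h₄, rfl⟩))

theorem tDK_lie_add_eq_zero (i j a : Fin r) (hij : i ≠ j) (hia : i ≠ a) (hja : j ≠ a) :
    ⁅tDK i j hij, tDK i a hia + tDK j a hja⁆ = 0 :=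
  dkMk_eq_zero_of_mem_relations (Or.inr ⟨i, j, a, hij, hia, hja, rfl⟩)

/-- A Lie subalgebra of `𝔭(r)` that contains the generators is everything. -/
theorem DK.lieSubalgebra_eq_top (S : LieSubalgebra ℚ (DK r))
    (h : ∀ i j (hij : i ≠ j), tDK i j hij ∈ S) : S = ⊤ := by
  have key := FreeLieAlgebra.lieSubalgebra_eq_top_of_forall_of_mem (S.comap (dkMk r))
    fun p => h p.1.1 p.1.2 p.2
  refine eq_top_iff.mpr fun y _ => ?_
  obtain ⟨x, rfl⟩ := dkMk_surjective r y
  have hx : x ∈ S.comap (dkMk r) := key ▸ LieSubalgebra.mem_top x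
  exact hx

theorem DK.hom_ext {f g : DK r →ₗ⁅ℚ⁆ L}
    (h : ∀ i j (hij : i ≠ j), f (tDK i j hij) = g (tDK i j hij)) : f = g := by
  have key : f.comp (dkMk r) = g.comp (dkMk r) :=
    FreeLieAlgebra.hom_ext fun p => h p.1.1 p.1.2 p.2
  ext y
  obtain ⟨x, rfl⟩ := dkMk_surjective r y
  exact LieHom.congr_fun key x

/-- The family of the generators `t i j`, extended by zero to the diagonal. -/
def tDKTotal (i j : Fin r) : DK r := if h : i ≠ j then tDK i j h else 0

theorem tDKTotal_of_ne {i j : Fin r} (h : i ≠ j) : tDKTotal i j = tDK i j h := dif_pos h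

theorem isDKFamily_tDKTotal : IsDKFamily (tDKTotal (r := r)) where
  symm i j h := by rw [tDKTotal_of_ne h, tDKTotal_of_ne h.symm, tDK_symm]
  lie_eq_zero i j a b hij hab h₁ h₂ h₃ h₄ := by
    rw [tDKTotal_of_ne hij, tDKTotal_of_ne hab, tDK_lie_eq_zero i j a b hij hab h₁ h₂ h₃ h₄]
  lie_add_eq_zero i j a hij hia hja := by
    rw [tDKTotal_of_ne hij, tDKTotal_of_ne hia, tDKTotal_of_ne hja, tDK_lie_add_eq_zero]

/-- The values of the derivation `ad t i j` on the generators `t 0 m`. -/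
def dkDerivationFun (i j m : Fin r) : FreeLieAlgebra ℚ (Fin r) :=
  if m = i then ⁅FreeLieAlgebra.of ℚ i, FreeLieAlgebra.of ℚ j⁆
  else if m = j then ⁅FreeLieAlgebra.of ℚ j, FreeLieAlgebra.of ℚ i⁆ else 0

/-- The derivation of the free Lie algebra that describes the action of `t i j`. -/
def dkDerivation (i j : Fin r) :
    LieDerivation ℚ (FreeLieAlgebra ℚ (Fin r)) (FreeLieAlgebra ℚ (Fin r)) :=
  FreeLieAlgebra.derivation (dkDerivationFun i j)

theorem dkDerivation_of (i j m : Fin r) :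
    dkDerivation i j (FreeLieAlgebra.of ℚ m) = dkDerivationFun i j m :=
  FreeLieAlgebra.derivation_of _ _

theorem dkDerivation_of_left (i j : Fin r) : dkDerivation i j (FreeLieAlgebra.of ℚ i) =
    ⁅FreeLieAlgebra.of ℚ i, FreeLieAlgebra.of ℚ j⁆ := by
  simp [dkDerivation_of, dkDerivationFun]

theorem dkDerivation_of_right {i j : Fin r} (h : i ≠ j) :
    dkDerivation i j (FreeLieAlgebra.of ℚ j) =
      ⁅FreeLieAlgebra.of ℚ j, FreeLieAlgebra.of ℚ i⁆ := by
  simp [dkDerivation_of, dkDerivationFun, h.symm]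

theorem dkDerivation_of_ne {i j m : Fin r} (hi : m ≠ i) (hj : m ≠ j) :
    dkDerivation i j (FreeLieAlgebra.of ℚ m) = 0 := by
  simp [dkDerivation_of, dkDerivationFun, hi, hj]

theorem isDKFamily_dkDerivation : IsDKFamily (dkDerivation (r := r)) where
  symm i j h := by
    refine FreeLieAlgebra.derivation_ext fun m => ?_
    by_cases hi : m = i
    · subst hi; rw [dkDerivation_of_left, dkDerivation_of_right h.symm]
    by_cases hj : m = j
    · subst hj; rw [dkDerivation_of_left, dkDerivation_of_right h]
    rw [dkDerivation_of_ne hi hj, dkDerivation_of_ne hj hi]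
  lie_eq_zero i j a b hij hab h₁ h₂ h₃ h₄ := by
    refine FreeLieAlgebra.derivation_ext fun m => ?_
    rw [LieDerivation.commutator_apply, LieDerivation.zero_apply]
    by_cases hi : m = i
    · subst hi
      simp [dkDerivation_of_left, dkDerivation_of_ne, *]
    by_cases hj : m = j
    · subst hj
      simp [dkDerivation_of_right, dkDerivation_of_ne, *]
    by_cases ha : m = a
    · subst ha
      simp [dkDerivation_of_left, dkDerivation_of_ne, *, Ne.symm]
    by_cases hb : m = b
    · subst hb
      simp [dkDerivation_of_right, dkDerivation_of_ne, *, Ne.symm]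
    simp [dkDerivation_of_ne, *]
  lie_add_eq_zero i j a hij hia hja := by
    refine FreeLieAlgebra.derivation_ext fun m => ?_
    rw [LieDerivation.commutator_apply, LieDerivation.zero_apply, sub_eq_zero]
    simp only [LieDerivation.add_apply]
    by_cases hi : m = i
    · subst hi
      simp only [dkDerivation_of_left, dkDerivation_of_ne hij hia, add_zero,
        LieDerivation.apply_lie_eq_add, dkDerivation_of_ne hia.symm hja.symm,
        dkDerivation_of_ne hij.symm hja, lie_zero, zero_add]
      rw [zero_lie, add_zero, lie_lie_eq_lie_lie_add]
    by_cases hj : m = j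
    · subst hj
      simp only [dkDerivation_of_left, dkDerivation_of_right hij, dkDerivation_of_ne hij.symm hja,
        zero_add, LieDerivation.apply_lie_eq_add, dkDerivation_of_ne hia.symm hja.symm,
        dkDerivation_of_ne hij hia, lie_zero]
      rw [zero_lie, add_zero, lie_lie_eq_lie_lie_add, add_comm]
    by_cases ha : m = a
    · subst ha
      simp only [dkDerivation_of_left, dkDerivation_of_right hia, dkDerivation_of_right hja,
        dkDerivation_of_right hij, dkDerivation_of_ne hia.symm hja.symm, map_add, map_zero,
        LieDerivation.apply_lie_eq_add, zero_lie, add_zero]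
      rw [← lie_add, ← lie_skew (FreeLieAlgebra.of ℚ i), neg_add_cancel, lie_zero]
    simp [dkDerivation_of_ne, *]

/-- The action of `𝔭(r)` on the free Lie algebra on `r` generators. -/
def dkAction (r : ℕ) : DK r →ₗ⁅ℚ⁆
    LieDerivation ℚ (FreeLieAlgebra ℚ (Fin r)) (FreeLieAlgebra ℚ (Fin r)) :=
  isDKFamily_dkDerivation.lift

theorem dkAction_tDK (i j : Fin r) (h : i ≠ j) : dkAction r (tDK i j h) = dkDerivation i j :=
  isDKFamily_dkDerivation.lift_tDK i j h

/-- The family `t 0 j ↦ (x_j, 0)`, `t i j ↦ (0, t (i - 1) (j - 1))` in the semidirect sum. -/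
def dkSemiDirectFamily (i j : Fin (r + 1)) :
    LieAlgebra.SemiDirectSum (FreeLieAlgebra ℚ (Fin r)) (DK r) (dkAction r) :=
  Fin.cases (Fin.cases 0 (fun j => ⟨FreeLieAlgebra.of ℚ j, 0⟩) j)
    (fun i => Fin.cases ⟨FreeLieAlgebra.of ℚ i, 0⟩ (fun j => ⟨0, tDKTotal i j⟩) j) i

@[simp]
theorem dkSemiDirectFamily_zero_succ (j : Fin r) :
    dkSemiDirectFamily 0 j.succ = ⟨FreeLieAlgebra.of ℚ j, 0⟩ := rfl

@[simp]
theorem dkSemiDirectFamily_succ_zero (i : Fin r) :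
    dkSemiDirectFamily i.succ 0 = ⟨FreeLieAlgebra.of ℚ i, 0⟩ := rfl

@[simp]
theorem dkSemiDirectFamily_succ_succ (i j : Fin r) :
    dkSemiDirectFamily i.succ j.succ = ⟨0, tDKTotal i j⟩ := rfl

theorem isDKFamily_dkSemiDirectFamily : IsDKFamily (dkSemiDirectFamily (r := r)) where
  symm i j h := by
    cases i using Fin.cases <;> cases j using Fin.cases
    · rfl
    · rfl
    · rfl
    · simp only [ne_eq, Fin.succ_inj] at h
      simp [isDKFamily_tDKTotal.symm _ _ h]
  lie_eq_zero i j a b hij hab h₁ h₂ h₃ h₄ := by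
    cases i using Fin.cases <;> cases j using Fin.cases <;> cases a using Fin.cases <;>
      cases b using Fin.cases <;>
      simp_all [tDKTotal_of_ne, dkAction_tDK, dkDerivation_of_ne, tDK_lie_eq_zero, Ne.symm, eq_comm]
  lie_add_eq_zero i j a hij hia hja := by
    cases i using Fin.cases <;> cases j using Fin.cases <;> cases a using Fin.cases <;>
      simp_all [tDKTotal_of_ne, dkAction_tDK, dkDerivation_of_left, dkDerivation_of_right,
        tDK_lie_add_eq_zero, -lie_add]
    rw [← lie_skew, neg_add_cancel]

/-- The morphism from `𝔭(r + 1)` to the semidirect sum of the free Lie algebra and `𝔭(r)`. -/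
def dkToSemiDirect (r : ℕ) : DK (r + 1) →ₗ⁅ℚ⁆
    LieAlgebra.SemiDirectSum (FreeLieAlgebra ℚ (Fin r)) (DK r) (dkAction r) :=
  isDKFamily_dkSemiDirectFamily.lift

theorem DKphi_of (j : Fin r) :
    DKphi r (FreeLieAlgebra.of ℚ j) = tDK 0 j.succ (Ne.symm (Fin.succ_ne_zero j)) :=
  FreeLieAlgebra.lift_of_apply _ _

theorem dkToSemiDirect_comp_DKphi (r : ℕ) :
    (dkToSemiDirect r).comp (DKphi r) = LieAlgebra.SemiDirectSum.inl (dkAction r) := by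
  ext1 j
  simp only [LieHom.comp_apply, DKphi_of, dkToSemiDirect, IsDKFamily.lift_tDK]
  rfl

theorem DKphi_injective (r : ℕ) : Function.Injective (DKphi r) := by
  have h := LieAlgebra.SemiDirectSum.inl_injective (dkAction r)
  rw [← dkToSemiDirect_comp_DKphi] at h
  exact Function.Injective.of_comp h

/-- The section `t i j ↦ t (i + 1) (j + 1)` of the strand-deleting morphism. -/
def dkSection (r : ℕ) : DK r →ₗ⁅ℚ⁆ DK (r + 1) :=
  isDKFamily_tDKTotal.comp_succ.lift

theorem dkSection_tDK (i j : Fin r) (h : i ≠ j) :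
    dkSection r (tDK i j h) = tDK i.succ j.succ fun e => h (Fin.succ_injective r e) :=
  (isDKFamily_tDKTotal.comp_succ.lift_tDK i j h).trans (tDKTotal_of_ne _)

theorem lie_dkSection_tDK_DKphi (i j : Fin r) (h : i ≠ j) (x : FreeLieAlgebra ℚ (Fin r)) :
    ⁅dkSection r (tDK i j h), DKphi r x⁆ = DKphi r (dkDerivation i j x) := by
  have hij : i.succ ≠ j.succ := fun e => h (Fin.succ_injective r e)
  have hz (m : Fin r) : m.succ ≠ 0 := Fin.succ_ne_zero m
  rw [dkSection_tDK i j h]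
  let S : LieSubalgebra ℚ (FreeLieAlgebra ℚ (Fin r)) :=
    { carrier := {x | ⁅tDK i.succ j.succ hij, DKphi r x⁆ = DKphi r (dkDerivation i j x)}
      add_mem' := fun {a b} ha hb => by
        change ⁅_, _⁆ = _ at ha hb ⊢
        rw [map_add, lie_add, ha, hb, map_add, map_add]
      zero_mem' := by simp
      smul_mem' := fun c a ha => by
        change ⁅_, _⁆ = _ at ha ⊢
        rw [map_smul, lie_smul, ha, map_smul, map_smul]
      lie_mem' := fun {a b} ha hb => by
        change ⁅_, DKphi r a⁆ = _ at ha
        change ⁅_, DKphi r b⁆ = _ at hb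
        change ⁅_, DKphi r ⁅a, b⁆⁆ = _
        rw [LieDerivation.apply_lie_eq_add, map_add, LieHom.map_lie, LieHom.map_lie,
          LieHom.map_lie, leibniz_lie, ha, hb]
        exact add_comm _ _ }
  suffices hS : S = ⊤ from (hS ▸ LieSubalgebra.mem_top x : x ∈ S)
  refine FreeLieAlgebra.lieSubalgebra_eq_top_of_forall_of_mem S fun m => ?_
  change ⁅_, DKphi r (FreeLieAlgebra.of ℚ m)⁆ = DKphi r _
  have key (a b : Fin r) (hab : a.succ ≠ b.succ) :
      ⁅tDK a.succ b.succ hab, tDK 0 a.succ (hz a).symm⁆ =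
      ⁅tDK 0 a.succ (hz a).symm, tDK 0 b.succ (hz b).symm⁆ := by
    have := tDK_lie_add_eq_zero a.succ 0 b.succ (hz a) hab (hz b).symm
    rw [lie_add, tDK_symm a.succ 0, ← lie_skew, neg_add_eq_zero] at this
    exact this
  by_cases hi : m = i
  · subst hi
    rw [dkDerivation_of_left, LieHom.map_lie, DKphi_of, DKphi_of, key]
  by_cases hj : m = j
  · subst hj
    rw [dkDerivation_of_right h, LieHom.map_lie, DKphi_of, DKphi_of, tDK_symm, key]
  rw [dkDerivation_of_ne hi hj, map_zero, DKphi_of]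
  exact tDK_lie_eq_zero _ _ _ _ _ _ (hz i) (by simpa using Ne.symm hi) (hz j)
    (by simpa using Ne.symm hj)

theorem lie_dkSection_DKphi (z : DK r) (x : FreeLieAlgebra ℚ (Fin r)) :
    ⁅dkSection r z, DKphi r x⁆ = DKphi r (dkAction r z x) := by
  let S : LieSubalgebra ℚ (DK r) :=
    { carrier := {z | ∀ x, ⁅dkSection r z, DKphi r x⁆ = DKphi r (dkAction r z x)}
      add_mem' := fun {a b} ha hb x => by
        rw [map_add, add_lie, ha, hb, map_add, LieDerivation.add_apply, map_add]
      zero_mem' := fun x => by simp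
      smul_mem' := fun c a ha x => by
        rw [map_smul, smul_lie, ha, map_smul, LieDerivation.smul_apply, map_smul]
      lie_mem' := fun {a b} ha hb x => by
        change ∀ x, _ = _ at ha hb
        rw [LieHom.map_lie, lie_lie, ha, hb, ha, hb, LieHom.map_lie,
          LieDerivation.commutator_apply, map_sub] }
  suffices hS : S = ⊤ from (hS ▸ LieSubalgebra.mem_top z : z ∈ S) x
  refine DK.lieSubalgebra_eq_top S fun i j hij x => ?_
  rw [dkAction_tDK, lie_dkSection_tDK_DKphi]

theorem exists_eq_DKphi_add_dkSection (y : DK (r + 1)) :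
    ∃ x z, y = DKphi r x + dkSection r z := by
  let S : LieSubalgebra ℚ (DK (r + 1)) :=
    { carrier := {y | ∃ x z, y = DKphi r x + dkSection r z}
      add_mem' := by
        rintro _ _ ⟨x, z, rfl⟩ ⟨x', z', rfl⟩
        exact ⟨x + x', z + z', by simp only [map_add]; abel⟩
      zero_mem' := ⟨0, 0, by simp⟩
      smul_mem' := by
        rintro c _ ⟨x, z, rfl⟩
        exact ⟨c • x, c • z, by simp only [map_smul, smul_add]⟩
      lie_mem' := by
        rintro _ _ ⟨x, z, rfl⟩ ⟨x', z', rfl⟩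
        refine ⟨⁅x, x'⁆ + dkAction r z x' - dkAction r z' x, ⁅z, z'⁆, ?_⟩
        simp only [add_lie, lie_add, map_add, map_sub, LieHom.map_lie, ← lie_dkSection_DKphi]
        rw [← lie_skew (dkSection r z') (DKphi r x)]
        abel }
  suffices hS : S = ⊤ from (hS ▸ LieSubalgebra.mem_top y : y ∈ S)
  have hzero (j : Fin r) : tDK 0 j.succ (Ne.symm (Fin.succ_ne_zero j)) ∈ S :=
    ⟨FreeLieAlgebra.of ℚ j, 0, by rw [DKphi_of, map_zero, add_zero]⟩
  refine DK.lieSubalgebra_eq_top S fun i j hij => ?_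
  cases i using Fin.cases with
  | zero =>
    cases j using Fin.cases with
    | zero => exact absurd rfl hij
    | succ j => exact hzero j
  | succ i =>
    cases j using Fin.cases with
    | zero => rw [tDK_symm]; exact hzero i
    | succ j =>
      have h : i ≠ j := fun e => hij (congrArg Fin.succ e)
      exact ⟨0, tDK i j h, by rw [dkSection_tDK, map_zero, zero_add]⟩

/-- The morphism `𝔭(r + 1) → 𝔭(r)` that deletes the first strand. -/
def dkDelete (r : ℕ) : DK (r + 1) →ₗ⁅ℚ⁆ DK r :=
  (LieAlgebra.SemiDirectSum.projr (dkAction r)).comp (dkToSemiDirect r)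

theorem dkDelete_tDK_zero_succ (j : Fin r) :
    dkDelete r (tDK 0 j.succ (Ne.symm (Fin.succ_ne_zero j))) = 0 := by
  simp [dkDelete, dkToSemiDirect]

theorem dkDelete_tDK_succ_succ (i j : Fin r) (h : i ≠ j) :
    dkDelete r (tDK i.succ j.succ fun e => h (Fin.succ_injective r e)) = tDK i j h := by
  simp [dkDelete, dkToSemiDirect, tDKTotal_of_ne h]

end DrinfeldKohno

/-- **Drinfeld–Kohno.**  For `r + 1 ≥ 2` strands (i.e. `r ≥ 1`):
(a) there is a unique Lie algebra homomorphism `s₁ : 𝔭(r+1) → 𝔭(r)` with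
`s₁ (t 0 j) = 0` for `j ≠ 0` and `s₁ (t i j) = t (i-1) (j-1)` for `i, j ≠ 0`
(all indices written zero-based, via `Fin.succ`); and
(b) for this `s₁`, the canonical Lie algebra map `φ` from the free Lie algebra on
the generators `t 0 1, …, t 0 r` is injective with image exactly the kernel of
`s₁`; in other words `ker s₁` is a free Lie algebra on these generators. -/
theorem drinfeldKohno_s1_exists_unique_and_ker_free (r : ℕ) (hr : 1 ≤ r) :
    (∃! s₁ : DK (r + 1) →ₗ⁅ℚ⁆ DK r,
      (∀ j : Fin r, s₁ (tDK (0 : Fin (r + 1)) j.succ (Ne.symm (Fin.succ_ne_zero j))) = 0) ∧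
      (∀ (i j : Fin r) (h : i ≠ j),
        s₁ (tDK i.succ j.succ fun e => h (Fin.succ_injective r e)) = tDK i j h)) ∧
    (∀ s₁ : DK (r + 1) →ₗ⁅ℚ⁆ DK r,
      ((∀ j : Fin r, s₁ (tDK (0 : Fin (r + 1)) j.succ (Ne.symm (Fin.succ_ne_zero j))) = 0) ∧
       (∀ (i j : Fin r) (h : i ≠ j),
         s₁ (tDK i.succ j.succ fun e => h (Fin.succ_injective r e)) = tDK i j h)) →
      Function.Injective ⇑(DKphi r) ∧
      ∀ y : DK (r + 1), (∃ x, DKphi r x = y) ↔ s₁ y = 0) := by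
  refine ⟨⟨dkDelete r, ⟨dkDelete_tDK_zero_succ, dkDelete_tDK_succ_succ⟩, ?_⟩, ?_⟩
  · rintro s ⟨h₀, h₁⟩
    refine DK.hom_ext fun i j hij => ?_
    cases i using Fin.cases with
    | zero =>
      cases j using Fin.cases with
      | zero => exact absurd rfl hij
      | succ j => rw [h₀, dkDelete_tDK_zero_succ]
    | succ i =>
      cases j using Fin.cases with
      | zero => rw [tDK_symm, h₀, dkDelete_tDK_zero_succ]
      | succ j =>
        have h : i ≠ j := fun e => hij (congrArg Fin.succ e)
        rw [h₁ i j h, dkDelete_tDK_succ_succ i j h]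
  · rintro s ⟨h₀, h₁⟩
    have hφ (x) : s (DKphi r x) = 0 := by
      have : s.comp (DKphi r) = 0 := by
        ext1 j
        simp [DKphi_of, h₀]
      exact LieHom.congr_fun this x
    have hσ (z) : s (dkSection r z) = z := by
      have : s.comp (dkSection r) = LieHom.id :=
        DK.hom_ext fun i j h => by simp [dkSection_tDK, h₁ i j h]
      exact LieHom.congr_fun this z
    refine ⟨DKphi_injective r, fun y => ⟨?_, fun hy => ?_⟩⟩
    · rintro ⟨x, rfl⟩
      exact hφ x
    · obtain ⟨x, z, rfl⟩ := exists_eq_DKphi_add_dkSection y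
      rw [map_add, hφ, hσ, zero_add] at hy
      exact ⟨x, by rw [hy, map_zero, add_zero]⟩
end
end
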